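/- There exist constants C'₀, C'₁, C'₂ > 0, depending only on σ and s, such that if k ≥ C'₀ and I is any oscillation interval of ξ_k, then there is a subinterval J' ⊂ I with the following properties: (i) q_k ≥ C'₁ k^{1/3} on J'; (ii) each connected component of I ∖ J' has length ≤ C'₂ k^{−1/6}. -/

import Mathlib

open MeasureTheory Real Set

/-- The function `q_k(x) = (2k+1+2σ)s − s²x² − σ̄_k x⁻²` with `σ̄_k = σ(σ−(−1)^k)`. -/
noncomputable def qk (σ s : ℝ) (k : ℕ) (x : ℝ) : ℝ :=
  (2 * k + 1 + 2 * σ) * s - s ^ 2 * x ^ 2 - σ * (σ - (-1 : ℝ) ^ k) * (x ^ 2)⁻¹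

/-- `I` is an oscillation interval of `ξ_k`: a maximal open interval on which `q_k`
is defined (i.e. not containing `0` unless `σ̄_k = 0`) and positive. -/
def IsOscInterval (σ s : ℝ) (k : ℕ) (I : Set ℝ) : Prop :=
  I.Nonempty ∧ IsOpen I ∧ I.OrdConnected ∧
    (σ * (σ - (-1 : ℝ) ^ k) = 0 ∨ (0 : ℝ) ∉ I) ∧ (∀ x ∈ I, 0 < qk σ s k x) ∧
    ∀ J : Set ℝ, J.Nonempty → IsOpen J → J.OrdConnected →
      (σ * (σ - (-1 : ℝ) ^ k) = 0 ∨ (0 : ℝ) ∉ J) → (∀ x ∈ J, 0 < qk σ s k x) → I ⊆ J → I = J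

/-- The function `ξ_k = |x|^σ p_k(x) e^{−sx²/2}`. -/
noncomputable def xiF (σ s : ℝ) (p : ℕ → Polynomial ℝ) (k : ℕ) (x : ℝ) : ℝ :=
  |x| ^ σ * ((p k).eval x * Real.exp (-s * x ^ 2 / 2))

theorem qk_neg (σ s : ℝ) (k : ℕ) (x : ℝ) : qk σ s k (-x) = qk σ s k x := by
  simp [qk]

theorem qk_sub_qk (σ s : ℝ) (k : ℕ) {u v : ℝ} (hu : u ≠ 0) (hv : v ≠ 0) :
    qk σ s k u - qk σ s k v =
      (v ^ 2 - u ^ 2) * (s ^ 2 - σ * (σ - (-1 : ℝ) ^ k) * (u ^ 2 * v ^ 2)⁻¹) := by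
  unfold qk
  field_simp
  ring

theorem abs_qk_coeff_le (σ : ℝ) (k : ℕ) :
    |σ * (σ - (-1 : ℝ) ^ k)| ≤ |σ| * (|σ| + 1) := by
  rw [abs_mul]
  have h := abs_sub σ ((-1 : ℝ) ^ k)
  rw [abs_pow, abs_neg, abs_one, one_pow] at h
  gcongr

/-- On the positive half-line, `q_k` is quasiconcave. -/
theorem min_qk_le_qk (σ s : ℝ) (k : ℕ) {u z v : ℝ} (hu : 0 < u) (huz : u ≤ z) (hzv : z ≤ v) :
    min (qk σ s k u) (qk σ s k v) ≤ qk σ s k z := by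
  have hz : 0 < z := hu.trans_le huz
  have hv : 0 < v := hz.trans_le hzv
  have h1 := qk_sub_qk σ s k hu.ne' hz.ne'
  have h2 := qk_sub_qk σ s k hz.ne' hv.ne'
  set a := σ * (σ - (-1 : ℝ) ^ k)
  have huz2 : 0 ≤ z ^ 2 - u ^ 2 := by nlinarith
  have hzv2 : 0 ≤ v ^ 2 - z ^ 2 := by nlinarith
  by_cases h : a * (z ^ 2 * v ^ 2)⁻¹ ≤ s ^ 2
  · apply min_le_of_right_le
    have := mul_nonneg hzv2 (sub_nonneg.2 h)
    linarith
  · push Not at h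
    apply min_le_of_left_le
    have ha : 0 ≤ a := by
      by_contra! ha
      have : a * (z ^ 2 * v ^ 2)⁻¹ ≤ 0 := mul_nonpos_of_nonpos_of_nonneg ha.le (by positivity)
      nlinarith [sq_nonneg s]
    have hle : a * (z ^ 2 * v ^ 2)⁻¹ ≤ a * (u ^ 2 * z ^ 2)⁻¹ := by
      rw [mul_comm (u ^ 2)]
      have : u ≤ v := huz.trans hzv
      gcongr
    have := mul_nonneg huz2 (sub_nonneg.2 (h.le.trans hle))
    linarith

/-- Superlevel sets of `q_k` in an interval on which `q_k` is defined are order connected. -/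
theorem ordConnected_superlevel_qk (σ s : ℝ) (k : ℕ) (c : ℝ) {I : Set ℝ} (hI : I.OrdConnected)
    (h0 : σ * (σ - (-1 : ℝ) ^ k) = 0 ∨ (0 : ℝ) ∉ I) :
    (I ∩ {x | c ≤ qk σ s k x}).OrdConnected := by
  refine ⟨?_⟩
  rintro u ⟨huI, hu⟩ v ⟨hvI, hv⟩ z ⟨huz, hzv⟩
  refine ⟨hI.out huI hvI ⟨huz, hzv⟩, ?_⟩
  simp only [mem_ofPred_eq] at hu hv ⊢
  rcases lt_or_ge 0 u with hu0 | hu0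
  · exact (le_min hu hv).trans (min_qk_le_qk σ s k hu0 huz hzv)
  rcases lt_or_ge v 0 with hv0 | hv0
  · have := min_qk_le_qk σ s k (neg_pos.2 hv0) (neg_le_neg hzv) (neg_le_neg huz)
    simp only [qk_neg] at this
    exact (le_min hv hu).trans this
  rcases h0 with ha | h0
  · simp only [qk, ha, zero_mul, sub_zero] at hu hv ⊢
    rcases le_total 0 z with hz | hz
    · have : s ^ 2 * z ^ 2 ≤ s ^ 2 * v ^ 2 := by gcongr
      linarith
    · have : z ^ 2 ≤ u ^ 2 := by nlinarith
      have : s ^ 2 * z ^ 2 ≤ s ^ 2 * u ^ 2 := by gcongr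
      linarith
  · exact absurd (hI.out huI hvI ⟨hu0, hv0⟩) h0

/-- An interval of the positive half-line on which `0 < q_k < s t²`, where `k = t⁶`,
has length `O(1 / t)`. -/
theorem sub_le_of_qk_lt {σ s : ℝ} (hσ : -(1/2) < σ) (hs : 0 < s) {k : ℕ} {t : ℝ}
    (ht : 1 ≤ t) (hkt : (k : ℝ) = t ^ 6) (hk : 8 * (|σ| * (|σ| + 1)) + 1 ≤ t ^ 6)
    {u v : ℝ} (hu : 0 < u) (huv : u ≤ v)
    (hpos : ∀ x ∈ Icc u v, 0 < qk σ s k x) (hlt : ∀ x ∈ Icc u v, qk σ s k x < s * t ^ 2) :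
    v - u ≤ (2 * (|σ| * (|σ| + 1)) / s + 1 + 1 / (√(1 / (2 * s)) * s)) / t := by
  have hM := abs_qk_coeff_le σ k
  have hM0 : 0 ≤ |σ| * (|σ| + 1) := by positivity
  set M := |σ| * (|σ| + 1)
  have ht0 : 0 < t := by linarith
  have hv : 0 < v := hu.trans_le huv
  have ht26 : t ^ 2 ≤ t ^ 6 := pow_le_pow_right₀ ht (by norm_num)
  have ht6 : 1 ≤ t ^ 6 := one_le_pow₀ ht
  set c := √(1 / (2 * s)) with hc
  have hc0 : 0 < c := by positivity
  have hc2 : c ^ 2 * (2 * s) = 1 := by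
    rw [hc, Real.sq_sqrt (by positivity)]
    field_simp
  have hx0 : 0 < c * t ^ 3 := by positivity
  have hx0sq : s * (c * t ^ 3) ^ 2 = t ^ 6 / 2 := by linear_combination t ^ 6 / 2 * hc2
  -- the level is only reached where `s² x² + M / x²` is large
  have key : ∀ x, 0 < x → qk σ s k x < s * t ^ 2 →
      s * t ^ 6 < s ^ 2 * x ^ 2 + M * (x ^ 2)⁻¹ := by
    intro x hx h
    have h1 : σ * (σ - (-1 : ℝ) ^ k) * (x ^ 2)⁻¹ ≤ M * (x ^ 2)⁻¹ := by
      gcongr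
      exact (le_abs_self _).trans hM
    have h2 : 0 < (1 + 2 * σ) * s := mul_pos (by linarith) hs
    have h3 : s * t ^ 2 ≤ s * t ^ 6 := by gcongr
    unfold qk at h
    rw [hkt] at h
    linarith
  rw [add_div, add_div _ _ t]
  rcases lt_or_ge v (c * t ^ 3) with hvc | hvc
  · have h := key v hv (hlt v ⟨huv, le_rfl⟩)
    have h1 : v ^ 2 < (c * t ^ 3) ^ 2 := by gcongr
    have h2 : s * v ^ 2 < t ^ 6 / 2 := by rw [← hx0sq]; gcongr
    have h3 : s * t ^ 6 / 2 < M * (v ^ 2)⁻¹ := by nlinarith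
    have h4 : s * t ^ 6 / 2 * v ^ 2 < M := by
      rwa [← div_eq_mul_inv, lt_div_iff₀ (by positivity)] at h3
    have h5 : s * t ^ 2 * v ^ 2 ≤ s * t ^ 6 * v ^ 2 := by gcongr
    have h6 : (t * v) ^ 2 ≤ 2 * M / s := by
      rw [le_div_iff₀ hs]
      linarith
    have h7 : t * v ≤ 2 * M / s + 1 := by nlinarith [sq_nonneg (t * v - 1)]
    have h8 : v ≤ (2 * M / s + 1) / t := by
      rw [le_div_iff₀ ht0]
      linarith
    have h9 : 0 ≤ 1 / (c * s) / t := by positivity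
    rw [add_div] at h8
    linarith
  rcases lt_or_ge u (c * t ^ 3) with huc | huc
  · exfalso
    have h := key _ hx0 (hlt _ ⟨huc.le, hvc⟩)
    have h1 : M * ((c * t ^ 3) ^ 2)⁻¹ ≤ s * t ^ 6 / 2 := by
      rw [← div_eq_mul_inv, div_le_iff₀ (by positivity)]
      nlinarith
    nlinarith
  · have hu2 : t ^ 6 / 2 ≤ s * u ^ 2 := by rw [← hx0sq]; gcongr
    have hv2 : t ^ 6 / 2 ≤ s * v ^ 2 := by rw [← hx0sq]; gcongr
    have huv2 : t ^ 6 / 2 * (t ^ 6 / 2) ≤ s * u ^ 2 * (s * v ^ 2) := by gcongr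
    have h1 : σ * (σ - (-1 : ℝ) ^ k) * (u ^ 2 * v ^ 2)⁻¹ ≤ s ^ 2 / 2 := by
      rw [← div_eq_mul_inv, div_le_iff₀ (by positivity)]
      have := (le_abs_self _).trans hM
      nlinarith
    have h2 := qk_sub_qk σ s k hu.ne' hv.ne'
    have h3 : (v ^ 2 - u ^ 2) * (s ^ 2 / 2) ≤ qk σ s k u - qk σ s k v := by
      rw [h2]
      have : 0 ≤ v ^ 2 - u ^ 2 := by nlinarith
      gcongr
      linarith
    have h4 := hpos v ⟨huv, le_rfl⟩
    have h5 := hlt u ⟨le_rfl, huv⟩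
    have h6 : (v - u) * (2 * (c * t ^ 3)) ≤ v ^ 2 - u ^ 2 := by nlinarith
    have h7 : (v - u) * (2 * (c * t ^ 3)) * (s ^ 2 / 2) ≤ s * t ^ 2 :=
      (mul_le_mul_of_nonneg_right h6 (by positivity)).trans (by linarith)
    have h8 : (v - u) * (c * s) * t * (s * t ^ 2) ≤ 1 * (s * t ^ 2) := by linarith
    have h9 := le_of_mul_le_mul_right h8 (by positivity)
    have h10 : v - u ≤ 1 / (c * s) / t := by
      rw [div_div, le_div_iff₀ (by positivity)]
      linarith
    have h11 : 0 ≤ 2 * M / s / t := by positivity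
    have h12 : 0 ≤ 1 / t := by positivity
    linarith

theorem subinterval_J'_exists (σ s : ℝ) (hσ : -(1/2) < σ) (hs : 0 < s)
    (p : ℕ → Polynomial ℝ)
    (hdeg : ∀ k, (p k).degree = k)
    (hlead : ∀ k, 0 < (p k).leadingCoeff)
    (horth : ∀ k l, (∫ x : ℝ,
        (p k).eval x * (p l).eval x * |x| ^ (2 * σ) * Real.exp (-s * x ^ 2)) =
        if k = l then 1 else 0) :
    ∃ C₀ > (0 : ℝ), ∃ C₁ > (0 : ℝ), ∃ C₂ > (0 : ℝ), ∀ k : ℕ, C₀ ≤ (k : ℝ) →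
      ∀ I : Set ℝ, IsOscInterval σ s k I →
        ∃ J : Set ℝ, J ⊆ I ∧ J.OrdConnected ∧
          -- (i) `q_k ≥ C₁ k^{1/3}` on `J`
          (∀ x ∈ J, C₁ * (k : ℝ) ^ ((1:ℝ)/3) ≤ qk σ s k x) ∧
          -- (ii) each connected component of `I ∖ J` has length `≤ C₂ k^{−1/6}`
          (∀ x ∈ I \ J, Metric.diam (connectedComponentIn (I \ J) x)
            ≤ C₂ * (k : ℝ) ^ (-(1/6) : ℝ)) := by
  refine ⟨8 * (|σ| * (|σ| + 1)) + 1, by positivity, s, hs,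
    2 * (|σ| * (|σ| + 1)) / s + 1 + 1 / (√(1 / (2 * s)) * s), by positivity, ?_⟩
  rintro k hk I ⟨-, -, hIc, h0, hpos, -⟩
  have hk1 : (1 : ℝ) ≤ k := le_trans (le_add_of_nonneg_left (by positivity)) hk
  obtain ⟨t, ht⟩ : ∃ t : ℝ, t = (k : ℝ) ^ ((1 : ℝ) / 6) := ⟨_, rfl⟩
  have ht1 : 1 ≤ t := ht ▸ Real.one_le_rpow hk1 (by norm_num)
  have ht6 : (k : ℝ) = t ^ 6 := by
    rw [ht, ← Real.rpow_mul_natCast (by positivity)]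
    norm_num
  have ht2 : (k : ℝ) ^ ((1 : ℝ) / 3) = t ^ 2 := by
    rw [ht, ← Real.rpow_mul_natCast (by positivity)]
    norm_num
  have htinv : (k : ℝ) ^ (-(1/6) : ℝ) = t⁻¹ := by
    rw [Real.rpow_neg (by positivity), ht]
  rw [ht2, htinv, ← div_eq_mul_inv]
  refine ⟨I ∩ {x | s * t ^ 2 ≤ qk σ s k x}, inter_subset_left,
    ordConnected_superlevel_qk σ s k _ hIc h0, fun x hx => hx.2, fun x _ => ?_⟩
  have hsub := connectedComponentIn_subset (I \ (I ∩ {x | s * t ^ 2 ≤ qk σ s k x})) x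
  have hconn : (connectedComponentIn (I \ (I ∩ {x | s * t ^ 2 ≤ qk σ s k x})) x).OrdConnected :=
    isPreconnected_connectedComponentIn.ordConnected
  have hC : 0 ≤ (2 * (|σ| * (|σ| + 1)) / s + 1 + 1 / (√(1 / (2 * s)) * s)) / t := by positivity
  refine Metric.diam_le_of_forall_dist_le hC ?_
  intro y hy z hz
  wlog hyz : y ≤ z generalizing y z
  · rw [dist_comm]
    exact this z hz y hy (le_of_not_ge hyz)
  rw [dist_comm, Real.dist_eq, abs_of_nonneg (sub_nonneg.2 hyz)]
  have hmem : ∀ w ∈ Icc y z, w ∈ I ∧ qk σ s k w < s * t ^ 2 := fun w hw => by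
    have := hsub (hconn.out hy hz hw)
    exact ⟨this.1, lt_of_not_ge fun h => this.2 ⟨this.1, h⟩⟩
  rcases lt_or_ge 0 y with hy0 | hy0
  · exact sub_le_of_qk_lt hσ hs ht1 ht6 (ht6 ▸ hk) hy0 hyz
      (fun w hw => hpos w (hmem w hw).1) (fun w hw => (hmem w hw).2)
  rcases lt_or_ge z 0 with hz0 | hz0
  · have hneg : ∀ w ∈ Icc (-z) (-y), -w ∈ Icc y z := fun w hw =>
      ⟨le_neg.2 hw.2, neg_le.2 hw.1⟩
    have := sub_le_of_qk_lt hσ hs ht1 ht6 (ht6 ▸ hk) (neg_pos.2 hz0) (neg_le_neg hyz)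
      (fun w hw => qk_neg σ s k w ▸ hpos _ (hmem _ (hneg w hw)).1)
      (fun w hw => qk_neg σ s k w ▸ (hmem _ (hneg w hw)).2)
    linarith
  · exfalso
    obtain ⟨h0I, hq⟩ := hmem 0 ⟨hy0, hz0⟩
    simp only [qk, ht6, ne_eq, OfNat.ofNat_ne_zero, not_false_eq_true, zero_pow, mul_zero,
      inv_zero, sub_zero] at hq
    have h26 : t ^ 2 ≤ t ^ 6 := pow_le_pow_right₀ ht1 (by norm_num)
    have h1 : 0 < (1 + 2 * σ) * s := mul_pos (by linarith) hs
    have h2 : s * t ^ 2 ≤ s * t ^ 6 := by gcongr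
    have h3 : 0 < s * t ^ 6 := by positivity
    linarith
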